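/- Suppose μ_X/σ_X = μ_Y/σ_Y. Let n ≥ 1, let Z̄_n be the mean of n independent PN(μ_X,μ_Y;σ_X²,σ_Y²;ρ) random variables, and write μ_k = E[(Z̄_n − (μ_Xμ_Y + n s_n ρ))^k] (with μ_k = 0 by convention for k < 0, μ_0 = 1 and μ_1 = 0). Then for every integer k ≥ 0: μ_{k+1} = k s_n(3ρ+1)·μ_k − k s_n((1+ρ)(3ρ−1)(k−1)s_n + μ_Xμ_Y(ρ−1) + n s_n(2ρ²+ρ−1) − (3ρ+1)(μ_Xμ_Y + n s_n ρ))·μ_{k−1} − s_n²(1+ρ)k(k−1)((μ_Xμ_Y + n s_n ρ)(3ρ−1) + n(1−ρ²)s_n + (1−ρ²)s_n(k−2))·μ_{k−2} − s_n³k(k−1)(k−2)(1−ρ²)(1+ρ)(μ_Xμ_Y + n s_n ρ)·μ_{k−3}. -/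

import Mathlib

open MeasureTheory ProbabilityTheory

/-- The product-normal law `PN(μX, μY; σX², σY²; ρ)`: the law of `X * Y` where
`X = μX + σX * U`, `Y = μY + σY * (ρ * U + √(1 - ρ²) * V)` and `U, V` are independent
standard normal random variables. -/
noncomputable def PN (μX μY σX σY ρ : ℝ) : Measure ℝ :=
  Measure.map
    (fun p : ℝ × ℝ =>
      (μX + σX * p.1) * (μY + σY * (ρ * p.1 + Real.sqrt (1 - ρ ^ 2) * p.2)))
    ((gaussianReal 0 1).prod (gaussianReal 0 1))

/-- The law of the mean `Z̄ₙ = n⁻¹ ∑ᵢ Zᵢ` of `n` independent random variables with law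
`PN(μX, μY; σX², σY²; ρ)`. -/
noncomputable def PNbar (n : ℕ) (μX μY σX σY ρ : ℝ) : Measure ℝ :=
  Measure.map (fun ω : Fin n → ℝ => (∑ i, ω i) / (n : ℝ))
    (Measure.pi fun _ : Fin n => PN μX μY σX σY ρ)

/-- The `k`-th derivative at `0` of `t ^ m * f t`. -/
theorem iteratedDeriv_pow_mul_zero {f : ℝ → ℝ} {k : ℕ} (m : ℕ) (hf : ContDiffAt ℝ k f 0) :
    iteratedDeriv k (fun t => t ^ m * f t) 0
      = (k.descFactorial m : ℝ) * iteratedDeriv (k - m) f 0 := by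
  rw [iteratedDeriv_fun_mul (by fun_prop) hf]
  simp only [iteratedDeriv_fun_pow_zero]
  by_cases hm : m ≤ k
  · rw [Finset.sum_eq_single m]
    · rw [Nat.descFactorial_eq_factorial_mul_choose]
      push_cast
      simp only [if_true]
      ring
    · intro i _ hi
      simp [hi]
    · intro h
      exact absurd (Finset.mem_range.2 (by omega)) h
  · rw [Nat.descFactorial_of_lt (by omega)]
    simp only [Nat.cast_zero, zero_mul]
    refine Finset.sum_eq_zero fun i hi => ?_
    have : i ≠ m := by
      have := Finset.mem_range.1 hi
      omega
    simp [this]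

/-- A first order linear differential equation with cubic coefficients near `0` turns into a
recursion for the derivatives of its solution at `0`. -/
theorem iteratedDeriv_succ_zero_of_cubic_ode {F : ℝ → ℝ} (hF : AnalyticAt ℝ F 0)
    {d₁ d₂ d₃ c₁ c₂ c₃ : ℝ}
    (hode : ∀ᶠ t in nhds (0 : ℝ), deriv F t + d₁ * (t ^ 1 * deriv F t) + d₂ * (t ^ 2 * deriv F t)
        + d₃ * (t ^ 3 * deriv F t)
      = c₁ * (t ^ 1 * F t) + c₂ * (t ^ 2 * F t) + c₃ * (t ^ 3 * F t)) (k : ℕ) :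
    iteratedDeriv (k + 1) F 0
        + d₁ * ((k.descFactorial 1 : ℝ) * iteratedDeriv (k - 1 + 1) F 0)
        + d₂ * ((k.descFactorial 2 : ℝ) * iteratedDeriv (k - 2 + 1) F 0)
        + d₃ * ((k.descFactorial 3 : ℝ) * iteratedDeriv (k - 3 + 1) F 0)
      = c₁ * ((k.descFactorial 1 : ℝ) * iteratedDeriv (k - 1) F 0)
        + c₂ * ((k.descFactorial 2 : ℝ) * iteratedDeriv (k - 2) F 0)
        + c₃ * ((k.descFactorial 3 : ℝ) * iteratedDeriv (k - 3) F 0) := by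
  have hF' : ContDiffAt ℝ k F 0 := hF.contDiffAt
  have hD : ContDiffAt ℝ k (deriv F) 0 := hF.deriv.contDiffAt
  have h := Filter.EventuallyEq.iteratedDeriv_eq k hode
  rw [iteratedDeriv_fun_add (by fun_prop) (by fun_prop),
    iteratedDeriv_fun_add (by fun_prop) (by fun_prop),
    iteratedDeriv_fun_add (by fun_prop) (by fun_prop),
    iteratedDeriv_fun_add (by fun_prop) (by fun_prop),
    iteratedDeriv_fun_add (by fun_prop) (by fun_prop)] at h
  simp only [iteratedDeriv_const_mul_field] at h
  simp only [iteratedDeriv_pow_mul_zero _ hF', iteratedDeriv_pow_mul_zero _ hD] at h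
  simpa only [iteratedDeriv_succ'] using h

/-- The Gaussian expectation of the exponential of a quadratic polynomial. -/
theorem integral_exp_quadratic_gaussianReal {a : ℝ} (b : ℝ) (ha : 0 < 1 - 2 * a) :
    ∫ x, Real.exp (a * x ^ 2 + b * x) ∂(gaussianReal 0 1)
      = Real.exp (b ^ 2 / (2 * (1 - 2 * a)) - Real.log (1 - 2 * a) / 2) := by
  rw [integral_gaussianReal_eq_integral_smul one_ne_zero, gaussianPDFReal_def]
  have key : ∀ x : ℝ, ((√(2 * Real.pi * (1 : NNReal)))⁻¹ *
        Real.exp (-(x - 0) ^ 2 / (2 * (1 : NNReal)))) • Real.exp (a * x ^ 2 + b * x)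
      = ((√(2 * Real.pi))⁻¹ * Real.exp (b ^ 2 / (2 * (1 - 2 * a))))
        * Real.exp (-((1 - 2 * a) / 2) * (x - b / (1 - 2 * a)) ^ 2) := by
    intro x
    simp only [NNReal.coe_one, mul_one, sub_zero, smul_eq_mul]
    rw [mul_assoc, mul_assoc, ← Real.exp_add, ← Real.exp_add]
    congr 2
    field_simp
    ring
  simp_rw [key]
  rw [integral_const_mul,
    integral_sub_right_eq_self (fun x : ℝ => Real.exp (-((1 - 2 * a) / 2) * x ^ 2)),
    integral_gaussian, Real.exp_sub, ← Real.log_sqrt ha.le, Real.exp_log (Real.sqrt_pos.2 ha),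
    show Real.pi / ((1 - 2 * a) / 2) = 2 * Real.pi / (1 - 2 * a) by field_simp,
    Real.sqrt_div (by positivity)]
  have : √(2 * Real.pi) ≠ 0 := by positivity
  field_simp

/-- The moment generating function of `PN` with equal mean to standard deviation ratios `r`. -/
theorem mgf_id_PN {σX σY ρ r t : ℝ} (hρ : ρ ^ 2 ≤ 1)
    (hp : 0 < 1 - (1 + ρ) * (σX * σY * t)) (hq : 0 < 1 + (1 - ρ) * (σX * σY * t)) :
    mgf id (PN (r * σX) (r * σY) σX σY ρ) t
      = Real.exp (r ^ 2 * (σX * σY * t) / (1 - (1 + ρ) * (σX * σY * t))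
          - Real.log (1 - (1 + ρ) * (σX * σY * t)) / 2
          - Real.log (1 + (1 - ρ) * (σX * σY * t)) / 2) := by
  rw [PN, mgf_id_map (by fun_prop), mgf]
  set τ := σX * σY * t with hτ
  set c := √(1 - ρ ^ 2) with hc
  have hc2 : c ^ 2 = 1 - ρ ^ 2 := Real.sq_sqrt (by linarith)
  set a := τ * ρ + τ ^ 2 * (1 - ρ ^ 2) / 2 with ha_def
  set b := 2 * a * r + τ * r * (1 - ρ) with hb_def
  have ha : 1 - 2 * a = (1 - (1 + ρ) * τ) * (1 + (1 - ρ) * τ) := by rw [ha_def]; ring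
  have ha' : 0 < 1 - 2 * a := ha ▸ mul_pos hp hq
  have hsplit : ∀ u v : ℝ,
      Real.exp (t * ((r * σX + σX * u) * (r * σY + σY * (ρ * u + c * v))))
        = Real.exp (τ * (r + u) * (r + ρ * u)) * Real.exp (0 * v ^ 2 + τ * c * (r + u) * v) := by
    intro u v
    rw [← Real.exp_add, hτ]
    congr 1
    ring
  have hinner : ∀ u : ℝ, ∫ v, Real.exp (t * ((r * σX + σX * u) *
        (r * σY + σY * (ρ * u + c * v)))) ∂(gaussianReal 0 1)
      = Real.exp (a * r ^ 2 + τ * r ^ 2 * (1 - ρ)) * Real.exp (a * u ^ 2 + b * u) := by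
    intro u
    simp_rw [hsplit]
    rw [integral_const_mul, integral_exp_quadratic_gaussianReal _ (by norm_num), ← Real.exp_add,
      ← Real.exp_add]
    congr 1
    simp only [mul_zero, sub_zero, Real.log_one, zero_div, mul_one, mul_pow, hc2]
    rw [hb_def, ha_def]
    ring
  have houter := integral_exp_quadratic_gaussianReal b ha'
  have hint : Integrable (fun p : ℝ × ℝ => Real.exp (t * ((r * σX + σX * p.1) *
      (r * σY + σY * (ρ * p.1 + c * p.2))))) ((gaussianReal 0 1).prod (gaussianReal 0 1)) := by
    rw [integrable_prod_iff (by fun_prop)]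
    constructor
    · refine Filter.Eventually.of_forall fun u => Integrable.of_integral_ne_zero ?_
      simp only [hinner]
      positivity
    · simp only [Real.norm_eq_abs, Real.abs_exp, hinner]
      refine Integrable.const_mul (Integrable.of_integral_ne_zero ?_) _
      rw [houter]
      positivity
  rw [integral_prod _ hint]
  simp only [hinner]
  rw [integral_const_mul, houter, ← Real.exp_add, ha, Real.log_mul hp.ne' hq.ne']
  congr 1
  have e : a * r ^ 2 + τ * r ^ 2 * (1 - ρ)
      + b ^ 2 / (2 * ((1 - (1 + ρ) * τ) * (1 + (1 - ρ) * τ)))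
      = r ^ 2 * τ / (1 - (1 + ρ) * τ) := by
    have hp' := hp.ne'
    have hq' := hq.ne'
    rw [hb_def, ha_def]
    generalize hP : 1 - (1 + ρ) * τ = p at hp'
    generalize hQ : 1 + (1 - ρ) * τ = q at hq'
    field_simp
    rw [← hP, ← hQ]
    ring
  linarith

instance isProbabilityMeasure_PN (μX μY σX σY ρ : ℝ) :
    IsProbabilityMeasure (PN μX μY σX σY ρ) :=
  Measure.isProbabilityMeasure_map (by fun_prop)

/-- The moment generating function of the centred sample mean in terms of that of one sample. -/
theorem mgf_sub_PNbar (n : ℕ) (μX μY σX σY ρ m t : ℝ) :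
    mgf (fun x => x - m) (PNbar n μX μY σX σY ρ) t
      = Real.exp (-(m * t)) * mgf id (PN μX μY σX σY ρ) (t / n) ^ n := by
  have h : ∀ ω : Fin n → ℝ, Real.exp (t * ((∑ i, ω i) / n - m))
      = Real.exp (-(m * t)) * ∏ i, Real.exp (t / n * id (ω i)) := by
    intro ω
    rw [← Real.exp_sum, ← Real.exp_add, ← Finset.mul_sum]
    congr 1
    simp only [id]
    ring
  rw [mgf, PNbar, integral_map (by fun_prop) (by fun_prop)]
  simp_rw [h]
  rw [integral_const_mul, integral_fintype_prod_eq_pow (fun x : ℝ => Real.exp (t / n * id x)),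
    Fintype.card_fin, mgf]

/-- In the case `μX/σX = μY/σY`: recursion for the central moments
`μₖ = E[(Z̄ₙ - (μXμY + n sₙ ρ))ᵏ]` of the mean `Z̄ₙ` of `n` independent
`PN(μX, μY; σX², σY²; ρ)` random variables (with the convention `μₖ = 0` for `k < 0`). -/
theorem central_moment_recursion_PNbar_equal_ratio
    (μX μY σX σY ρ : ℝ) (hσX : 0 < σX) (hσY : 0 < σY)
    (hρ₁ : -1 < ρ) (hρ₂ : ρ < 1) (heq : μX / σX = μY / σY)
    (n : ℕ) (hn : 1 ≤ n)
    (s : ℝ) (hs : s = σX * σY / n)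
    (M : ℤ → ℝ)
    (hMneg : ∀ k : ℤ, k < 0 → M k = 0)
    (hMnat : ∀ k : ℕ,
      M k = ∫ x, (x - (μX * μY + n * s * ρ)) ^ k ∂(PNbar n μX μY σX σY ρ)) :
    ∀ k : ℕ,
      M (k + 1)
        = k * s * (3 * ρ + 1) * M k
          - k * s * ((1 + ρ) * (3 * ρ - 1) * (k - 1) * s + μX * μY * (ρ - 1)
              + n * s * (2 * ρ ^ 2 + ρ - 1)
              - (3 * ρ + 1) * (μX * μY + n * s * ρ)) * M (k - 1)
          - s ^ 2 * (1 + ρ) * k * (k - 1) * ((μX * μY + n * s * ρ) * (3 * ρ - 1)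
              + n * (1 - ρ ^ 2) * s + (1 - ρ ^ 2) * s * (k - 2)) * M (k - 2)
          - s ^ 3 * k * (k - 1) * (k - 2) * (1 - ρ ^ 2) * (1 + ρ)
            * (μX * μY + n * s * ρ) * M (k - 3) := by
  obtain ⟨r, rfl, rfl⟩ : ∃ r, μX = r * σX ∧ μY = r * σY :=
    ⟨μX / σX, by field_simp, by rw [heq]; field_simp⟩
  have hn0 : (n : ℝ) ≠ 0 := by positivity
  have hns : (n : ℝ) * s = σX * σY := by rw [hs]; field_simp
  set m := r * σX * (r * σY) + n * s * ρ with hm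
  have hm' : m = n * s * (r ^ 2 + ρ) := by
    rw [hm, mul_add, hns]; ring
  set F := mgf (fun x => x - m) (PNbar n (r * σX) (r * σY) σX σY ρ) with hF
  let H : ℝ → ℝ := fun t => -(m * t) + n * (r ^ 2 * (s * t) / (1 - (1 + ρ) * (s * t))
    - Real.log (1 - (1 + ρ) * (s * t)) / 2 - Real.log (1 + (1 - ρ) * (s * t)) / 2)
  have hpos : ∀ᶠ t in nhds (0 : ℝ), 0 < 1 - (1 + ρ) * (s * t) ∧ 0 < 1 + (1 - ρ) * (s * t) := by
    refine Filter.Eventually.and ?_ ?_ <;>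
    · refine ContinuousAt.eventually_lt (by fun_prop) (by fun_prop) ?_
      norm_num
  have hFH : ∀ᶠ t in nhds (0 : ℝ), F t = Real.exp (H t) := by
    filter_upwards [hpos] with t ht
    have hst : σX * σY * (t / n) = s * t := by rw [← hns]; field_simp
    rw [hF, mgf_sub_PNbar, mgf_id_PN (by nlinarith) (by rw [hst]; exact ht.1)
      (by rw [hst]; exact ht.2), hst, ← Real.exp_nat_mul, ← Real.exp_add]
  have hint : (0 : ℝ) ∈ interior (integrableExpSet (fun x => x - m)
      (PNbar n (r * σX) (r * σY) σX σY ρ)) := by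
    rw [mem_interior_iff_mem_nhds]
    filter_upwards [hFH] with t ht
    refine Integrable.of_integral_ne_zero ?_
    change F t ≠ 0
    rw [ht]
    positivity
  have hmom : ∀ k : ℕ, iteratedDeriv k F 0 = M k := fun k => by
    rw [hMnat, iteratedDeriv_mgf_zero hint]
    rfl
  have hode : ∀ᶠ t in nhds (0 : ℝ), deriv F t + (-(s * (3 * ρ + 1))) * (t ^ 1 * deriv F t)
        + (s ^ 2 * (1 + ρ) * (3 * ρ - 1)) * (t ^ 2 * deriv F t)
        + (s ^ 3 * (1 + ρ) ^ 2 * (1 - ρ)) * (t ^ 3 * deriv F t)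
      = (-(s * (n * s * r ^ 2 * (ρ - 1) + n * s * (2 * ρ ^ 2 + ρ - 1) - (3 * ρ + 1) * m)))
          * (t ^ 1 * F t)
        + (-(s ^ 2 * (1 + ρ) * (m * (3 * ρ - 1) + n * (1 - ρ ^ 2) * s))) * (t ^ 2 * F t)
        + (-(s ^ 3 * (1 - ρ ^ 2) * (1 + ρ) * m)) * (t ^ 3 * F t) := by
    filter_upwards [hFH.eventually_nhds, hpos] with t ht ⟨hp, hq⟩
    have hp' := hp.ne'
    have hq' := hq.ne'
    have hst : HasDerivAt (fun x : ℝ => s * x) s t := by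
      simpa using (hasDerivAt_id t).const_mul s
    have hpd := (hst.const_mul (1 + ρ)).const_sub 1
    have hqd := (hst.const_mul (1 - ρ)).const_add 1
    have hH := ((hasDerivAt_id' t).const_mul m).neg.add
      (((((hst.const_mul (r ^ 2)).div hpd hp').sub ((hpd.log hp').div_const 2)).sub
        ((hqd.log hq').div_const 2)).const_mul (n : ℝ))
    have hd : deriv F t = _ := (Filter.EventuallyEq.deriv_eq ht).trans hH.exp.deriv
    have hFt : F t = Real.exp (H t) := ht.self_of_nhds
    have hd' : deriv F t = F t * (-(m * 1) + n * (
        (r ^ 2 * s * (1 - (1 + ρ) * (s * t)) - r ^ 2 * (s * t) * -((1 + ρ) * s))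
          / (1 - (1 + ρ) * (s * t)) ^ 2
        - -((1 + ρ) * s) / (1 - (1 + ρ) * (s * t)) / 2
        - (1 - ρ) * s / (1 + (1 - ρ) * (s * t)) / 2)) := by
      rw [hFt]
      exact hd
    rw [hd', hm']
    generalize hP : 1 - (1 + ρ) * (s * t) = p at hp'
    generalize hQ : 1 + (1 - ρ) * (s * t) = q at hq'
    field_simp
    rw [← hP, ← hQ]
    ring
  have hF0 : AnalyticAt ℝ F 0 := analyticAt_mgf hint
  have hrr : r * σX * (r * σY) = n * s * r ^ 2 := by rw [hns]; ring
  rw [hrr]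
  intro k
  have h := iteratedDeriv_succ_zero_of_cubic_ode hF0 hode k
  simp only [hmom] at h
  match k with
  | 0 => simpa using h
  | 1 =>
    norm_num at h ⊢
    linear_combination h
  | 2 =>
    norm_num [Nat.descFactorial] at h ⊢
    linear_combination h
  | k + 3 =>
    have f₀ : (((k + 3 : ℕ) : ℤ) + 1) = ((k + 3 + 1 : ℕ) : ℤ) := by push_cast; ring
    have f₁ : (((k + 3 : ℕ) : ℤ) - 1) = ((k + 2 : ℕ) : ℤ) := by push_cast; ring
    have f₂ : (((k + 3 : ℕ) : ℤ) - 2) = ((k + 1 : ℕ) : ℤ) := by push_cast; ring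
    have f₃ : (((k + 3 : ℕ) : ℤ) - 3) = (k : ℤ) := by push_cast; ring
    have g₁ : ((k + 3).descFactorial 1 : ℝ) = k + 3 := by simp
    have g₂ : ((k + 3).descFactorial 2 : ℝ) = (k + 3) * (k + 2) := by
      simp [Nat.descFactorial]; ring
    have g₃ : ((k + 3).descFactorial 3 : ℝ) = (k + 3) * (k + 2) * (k + 1) := by
      simp [Nat.descFactorial]; ring
    rw [f₀, f₁, f₂, f₃]
    rw [g₁, g₂, g₃, show k + 3 - 1 = k + 2 from rfl, show k + 3 - 2 = k + 1 from rfl,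
      show k + 3 - 3 = k from rfl, show k + 2 + 1 = k + 3 from rfl,
      show k + 1 + 1 = k + 2 from rfl] at h
    rw [show ((k + 3 : ℕ) : ℝ) = k + 3 by push_cast; ring]
    linear_combination h
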